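/- For every δ > 0 there exist constants c > 0 and C > 0 such that for all complex z ≠ 0 with |arg z| ≤ π − δ and all real x ≥ 0, one has |Ai(z + x) / Ai(z)| ≤ C · exp( −c·x·|z|^{1/2} − c·x^{3/2} ). (In particular Ai(z) ≠ 0 for such z, since all zeros of Ai lie on the negative real axis.) -/

import Mathlib

open MeasureTheory ProbabilityTheory Complex Filter Topology

noncomputable section

/-- The Airy function `Ai`, defined via the contour-integral representation
`Ai(z) = (2π)⁻¹ ∫_ℝ exp((σ+it)³/3 − z(σ+it)) dt` with `σ = 1`. -/
def Ai (z : ℂ) : ℂ :=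
  ((2 * Real.pi : ℝ) : ℂ)⁻¹ *
    ∫ t : ℝ, Complex.exp ((1 + t * Complex.I) ^ 3 / 3 - z * (1 + t * Complex.I))

lemma airy_re_formula (a b : ℂ) (t : ℝ) :
    (-a * (t:ℂ)^2 + b * t - Complex.I * (t:ℂ)^3 / 3).re = -a.re * t^2 + b.re * t := by
  have h2 : ((t:ℂ)^2) = ((t^2 : ℝ) : ℂ) := by push_cast; ring
  have h3 : Complex.I * (t:ℂ)^3 / 3 = Complex.I * ((t^3 / 3 : ℝ) : ℂ) := by push_cast; ring
  rw [h2, h3]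
  simp only [Complex.sub_re, Complex.add_re, Complex.mul_re, Complex.neg_re, Complex.neg_im,
    Complex.ofReal_re, Complex.ofReal_im, Complex.I_re, Complex.I_im]
  ring

lemma airy_norm_exp (a b : ℂ) (t : ℝ) :
    ‖Complex.exp (-a * (t:ℂ)^2 + b * t - Complex.I * (t:ℂ)^3 / 3)‖
      = Real.exp (-a.re * t^2 + b.re * t) := by
  rw [Complex.norm_exp, airy_re_formula]

lemma airy_dom (k : ℕ) (α B : ℝ) (hα : 0 < α) :
    Integrable (fun t : ℝ => |t|^k * Real.exp (-α * t^2 + B * |t|)) := by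
  have h := (integrable_rpow_mul_exp_neg_mul_sq (b := α/2) (by positivity) (s := (k:ℝ))
    (by have : (0:ℝ) ≤ k := by positivity
        linarith)).norm.const_mul (Real.exp (B^2/(2*α)))
  refine h.mono' (by fun_prop) (Eventually.of_forall fun t => ?_)
  rw [Real.norm_of_nonneg (by positivity), norm_mul, Real.rpow_natCast, norm_pow, Real.norm_eq_abs,
    Real.norm_of_nonneg (Real.exp_pos _).le]
  have : Real.exp (-α * t^2 + B * |t|) ≤ Real.exp (B^2/(2*α)) * Real.exp (-(α/2) * t^2) := by
    rw [← Real.exp_add]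
    apply Real.exp_le_exp.2
    have h1 : B^2/(2*α) + -(α/2) * t^2 - (-α * t^2 + B * |t|) = (α*|t| - B)^2/(2*α) := by
      rw [← sq_abs t]; field_simp; ring
    have : 0 ≤ (α*|t| - B)^2/(2*α) := by positivity
    linarith
  calc |t|^k * Real.exp (-α * t^2 + B * |t|) 
      ≤ |t|^k * (Real.exp (B^2/(2*α)) * Real.exp (-(α/2) * t^2)) := by gcongr
    _ = _ := by ring

/-- Gaussian-Airy moments. -/
def airyM (k : ℕ) (a b : ℂ) : ℂ :=
  ∫ t : ℝ, (t:ℂ)^k * Complex.exp (-a * (t:ℂ)^2 + b * t - Complex.I * (t:ℂ)^3 / 3)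

lemma airy_bound (k : ℕ) (a b : ℂ) (α B : ℝ) (ha : α ≤ a.re) (hb : |b.re| ≤ B) (t : ℝ) :
    ‖(t:ℂ)^k * Complex.exp (-a * (t:ℂ)^2 + b * t - Complex.I * (t:ℂ)^3 / 3)‖
      ≤ |t|^k * Real.exp (-α * t^2 + B * |t|) := by
  rw [norm_mul, airy_norm_exp, norm_pow, Complex.norm_real, Real.norm_eq_abs]
  have h1 : b.re * t ≤ B * |t| := by
    calc b.re * t ≤ |b.re * t| := le_abs_self _
      _ = |b.re| * |t| := abs_mul _ _
      _ ≤ _ := by gcongr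
  have h2 : α * t^2 ≤ a.re * t^2 := by gcongr
  gcongr
  

lemma airy_integrable (k : ℕ) (a b : ℂ) (ha : 0 < a.re) :
    Integrable (fun t : ℝ => 
      (t:ℂ)^k * Complex.exp (-a * (t:ℂ)^2 + b * t - Complex.I * (t:ℂ)^3 / 3)) := by
  refine (airy_dom k a.re |b.re| ha).mono' (by fun_prop) (Eventually.of_forall fun t => ?_)
  exact airy_bound k a b _ _ le_rfl le_rfl t

lemma airyM_norm_le (k : ℕ) (a b : ℂ) (ha : 0 < a.re) :
    ‖airyM k a b‖ ≤ ∫ t : ℝ, |t|^k * Real.exp (-a.re * t^2 + |b.re| * |t|) := by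
  refine norm_integral_le_of_norm_le (airy_dom k a.re |b.re| ha) (Eventually.of_forall fun t => ?_)
  exact airy_bound k a b _ _ le_rfl le_rfl t

lemma airyM_hasDerivAt (k : ℕ) (a b : ℂ → ℂ) (ha : Differentiable ℂ a) (hb : Differentiable ℂ b)
    (u : ℂ) (hu : 0 < (a u).re) :
    HasDerivAt (fun u => airyM k (a u) (b u))
      (- deriv a u * airyM (k+2) (a u) (b u) + deriv b u * airyM (k+1) (a u) (b u)) u := by
  set α := (a u).re / 2 with hα
  have hα0 : 0 < α := by positivity
  have ca' : Continuous (deriv a) := (ha.contDiff (n := 1)).continuous_deriv le_rfl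
  have cb' : Continuous (deriv b) := (hb.contDiff (n := 1)).continuous_deriv le_rfl
  have ev : ∀ᶠ v in 𝓝 u, α < (a v).re ∧ |(b v).re| < |(b u).re| + 1 ∧
      ‖deriv a v‖ < ‖deriv a u‖ + 1 ∧ ‖deriv b v‖ < ‖deriv b u‖ + 1 := by
    refine Filter.Eventually.and ?_ (Filter.Eventually.and ?_ (Filter.Eventually.and ?_ ?_))
    · have : ContinuousAt (fun v => (a v).re) u := by
        have := ha.continuous; fun_prop
      exact this.eventually (lt_mem_nhds (by linarith))
    · have : ContinuousAt (fun v => |(b v).re|) u := by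
        have := hb.continuous; fun_prop
      exact this.eventually (gt_mem_nhds (by linarith))
    · have : ContinuousAt (fun v => ‖deriv a v‖) u := by fun_prop
      exact this.eventually (gt_mem_nhds (by linarith))
    · have : ContinuousAt (fun v => ‖deriv b v‖) u := by fun_prop
      exact this.eventually (gt_mem_nhds (by linarith))
  set B := |(b u).re| + 1
  set A' := ‖deriv a u‖ + 1
  set B' := ‖deriv b u‖ + 1
  have key := hasDerivAt_integral_of_dominated_loc_of_deriv_le (μ := volume) (𝕜 := ℂ)
    (F := fun v (t:ℝ) => 
      (t:ℂ)^k * Complex.exp (-(a v) * (t:ℂ)^2 + (b v) * t - Complex.I * (t:ℂ)^3 / 3))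
    (F' := fun v (t:ℝ) => 
      - deriv a v * ((t:ℂ)^(k+2) * Complex.exp (-(a v) * (t:ℂ)^2 + (b v) * t - Complex.I * (t:ℂ)^3 / 3))
      + deriv b v * ((t:ℂ)^(k+1) * Complex.exp (-(a v) * (t:ℂ)^2 + (b v) * t - Complex.I * (t:ℂ)^3 / 3)))
    (bound := fun t => A' * (|t|^(k+2) * Real.exp (-α * t^2 + B * |t|))
      + B' * (|t|^(k+1) * Real.exp (-α * t^2 + B * |t|)))
    (x₀ := u) ev
    (Eventually.of_forall fun v => by fun_prop) (airy_integrable k _ _ hu)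
    (by fun_prop)
    (Eventually.of_forall fun t v hv => by
      obtain ⟨h1, h2, h3, h4⟩ := hv
      refine (norm_add_le _ _).trans ?_
      rw [norm_mul (- deriv a v), norm_mul (deriv b v), norm_neg]
      exact add_le_add
        (mul_le_mul h3.le (airy_bound (k+2) _ _ _ _ h1.le h2.le t) (norm_nonneg _) (by positivity))
        (mul_le_mul h4.le (airy_bound (k+1) _ _ _ _ h1.le h2.le t) (norm_nonneg _) (by positivity)))
    (((airy_dom _ _ _ hα0).const_mul _).add ((airy_dom _ _ _ hα0).const_mul _))
    (Eventually.of_forall fun t v _ => by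
      have h1 := (ha v).hasDerivAt
      have h2 := (hb v).hasDerivAt
      have h3 := ((((h1.neg.mul_const ((t:ℂ)^2)).add (h2.mul_const (t:ℂ))).sub_const
        (Complex.I * (t:ℂ)^3 / 3)).cexp).const_mul ((t:ℂ)^k)
      refine h3.congr_deriv ?_
      simp only [Pi.add_apply, Pi.neg_apply]
      ring)
  have h := key.2
  rw [integral_add ((airy_integrable _ _ _ hu).const_mul _) ((airy_integrable _ _ _ hu).const_mul _),
    integral_const_mul, integral_const_mul] at h
  exact h

lemma airyM_ibp (a b : ℂ) (ha : 0 < a.re) :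
    -2 * a * airyM 1 a b + b * airyM 0 a b - Complex.I * airyM 2 a b = 0 := by
  have i0 := airy_integrable 0 a b ha
  have i1 := airy_integrable 1 a b ha
  have i2 := airy_integrable 2 a b ha
  have h := integral_eq_zero_of_hasDerivAt_of_integrable
    (f := fun t : ℝ => (t:ℂ)^0 * Complex.exp (-a * (t:ℂ)^2 + b * t - Complex.I * (t:ℂ)^3 / 3))
    (f' := fun t : ℝ => 
      -2 * a * ((t:ℂ)^1 * Complex.exp (-a * (t:ℂ)^2 + b * t - Complex.I * (t:ℂ)^3 / 3))
      + b * ((t:ℂ)^0 * Complex.exp (-a * (t:ℂ)^2 + b * t - Complex.I * (t:ℂ)^3 / 3))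
      - Complex.I * ((t:ℂ)^2 * Complex.exp (-a * (t:ℂ)^2 + b * t - Complex.I * (t:ℂ)^3 / 3)))
    (fun t => by
      have h0 : HasDerivAt (fun t : ℝ => (t:ℂ)) 1 t := Complex.ofRealCLM.hasDerivAt
      have h3 := (((((h0.pow 2).const_mul (-a)).add (h0.const_mul b)).sub
        (((h0.pow 3).const_mul Complex.I).div_const 3)).cexp).const_mul ((1:ℂ))
      simp only [pow_zero]
      refine h3.congr_deriv ?_ |>.congr_of_eventuallyEq (Eventually.of_forall fun t => ?_)
      · simp
        ring
      · simp)
    (((i1.const_mul _).add (i0.const_mul _)).sub (i2.const_mul _)) i0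
  have e1 := integral_sub (((i1.const_mul (-2*a)).add (i0.const_mul b))) (i2.const_mul Complex.I)
  have e2 := integral_add (i1.const_mul (-2*a)) (i0.const_mul b)
  simp only [Pi.add_apply] at e1
  rw [e1, e2, integral_const_mul, integral_const_mul, integral_const_mul] at h
  exact h

lemma Ai_eq_airyM (z : ℂ) : Ai z = ((2 * Real.pi : ℝ) : ℂ)⁻¹ * 
    (Complex.exp (1/3 - z) * airyM 0 1 (Complex.I * (1 - z))) := by
  rw [Ai, airyM]
  congr 1
  rw [← integral_const_mul]
  congr 1
  funext t
  rw [pow_zero, one_mul, ← Complex.exp_add]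
  congr 1
  have := Complex.I_sq
  have h3 : Complex.I^3 = -Complex.I := by rw [pow_succ, this]; ring
  linear_combination ((t:ℂ)^2) * this + (t:ℂ)^3 / 3 * h3

/-- the contour shift -/
lemma airy_shift (w : ℂ) (hw : 0 < w.re) :
    Complex.exp (1/3 - w^2) * airyM 0 1 (Complex.I * (1 - w^2)) =
      Complex.exp (-(2/3) * w^3) * airyM 0 w 0 := by
  set H : ℂ → ℂ := fun a => Complex.exp (a^3/3 - w^2 * a) * airyM 0 a (Complex.I * (a^2 - w^2))
    with hH
  have hd : ∀ a ∈ {a : ℂ | 0 < a.re}, HasDerivAt H 0 a := by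
    intro a ha
    have ha' : 0 < a.re := ha
    have h1 := airyM_hasDerivAt 0 (fun a => a) (fun a => Complex.I * (a^2 - w^2)) differentiable_id
      (by fun_prop) a ha'
    have h2 : HasDerivAt (fun a : ℂ => Complex.exp (a^3/3 - w^2 * a))
        (Complex.exp (a^3/3 - w^2*a) * (a^2 - w^2)) a := by
      have := ((((hasDerivAt_id a).pow 3).div_const 3).sub ((hasDerivAt_id a).const_mul (w^2))).cexp
      refine this.congr_deriv ?_
      simp
    have hb : deriv (fun a : ℂ => Complex.I * (a^2 - w^2)) a = Complex.I * (2 * a) := by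
      have := (((hasDerivAt_id a).pow 2).sub_const (w^2)).const_mul Complex.I
      have := this.deriv
      simpa using this
    have h3 := h2.mul h1
    rw [hb] at h3
    refine h3.congr_deriv ?_
    have hi := airyM_ibp a (Complex.I * (a^2 - w^2)) ha'
    simp only [deriv_id'', zero_add]
    have := Complex.I_sq
    linear_combination (-Complex.exp (a^3/3 - w^2*a)) * (Complex.I * hi - 
      ((a^2 - w^2) * airyM 0 a (Complex.I * (a^2 - w^2)) - airyM 2 a (Complex.I * (a^2 - w^2))) * this)
  have ho : IsOpen {a : ℂ | 0 < a.re} := isOpen_lt continuous_const Complex.continuous_re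
  have hc : IsPreconnected {a : ℂ | 0 < a.re} := (convex_halfSpace_re_gt 0).isPreconnected
  have := ho.is_const_of_deriv_eq_zero hc
    (fun a ha => (hd a ha).differentiableAt.differentiableWithinAt)
    (fun a ha => (hd a ha).deriv) (x := 1) (y := w) (by simp) hw
  simp only [hH] at this
  rw [one_pow, one_pow, mul_one] at this
  rw [this]
  congr 2
  · ring
  · ring

lemma Ai_sq (w : ℂ) (hw : 0 < w.re) :
    Ai (w^2) = ((2 * Real.pi : ℝ) : ℂ)⁻¹ * (Complex.exp (-(2/3) * w^3) * airyM 0 w 0) := by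
  rw [Ai_eq_airyM, airy_shift w hw]

/-- derivative of Ai -/
def Ai1 (z : ℂ) : ℂ := ((2 * Real.pi : ℝ) : ℂ)⁻¹ * 
    (Complex.exp (1/3 - z) * (- airyM 0 1 (Complex.I * (1 - z)) -
      Complex.I * airyM 1 1 (Complex.I * (1 - z))))

lemma airyM_hasDerivAt' (k : ℕ) (z : ℂ) :
    HasDerivAt (fun z => airyM k 1 (Complex.I * (1 - z)))
      (-Complex.I * airyM (k+1) 1 (Complex.I * (1 - z))) z := by
  have h1 := airyM_hasDerivAt k (fun _ => 1) (fun a => Complex.I * (1 - a)) (by fun_prop)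
      (by fun_prop) z (by simp)
  have hb : deriv (fun a : ℂ => Complex.I * (1 - a)) z = - Complex.I := by
    have := (((hasDerivAt_id z)).const_sub 1).const_mul Complex.I
    have := this.deriv
    simpa using this
  rw [hb] at h1
  simpa using h1

lemma exp_hasDerivAt' (z : ℂ) :
    HasDerivAt (fun z : ℂ => Complex.exp (1/3 - z)) (-Complex.exp (1/3 - z)) z := by
  have := (((hasDerivAt_id z)).const_sub (1/3)).cexp
  simpa using this

lemma Ai_hasDerivAt (z : ℂ) : HasDerivAt Ai (Ai1 z) z := by
  have h := ((exp_hasDerivAt' z).mul (airyM_hasDerivAt' 0 z)).const_mul ((2 * Real.pi : ℝ) : ℂ)⁻¹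
  have e : Ai = fun z => ((2 * Real.pi : ℝ) : ℂ)⁻¹ * 
    (Complex.exp (1/3 - z) * airyM 0 1 (Complex.I * (1 - z))) := by
    ext z; exact Ai_eq_airyM z
  rw [e]
  refine h.congr_deriv ?_
  rw [Ai1]; simp only [zero_add]; ring

lemma Ai1_hasDerivAt (z : ℂ) : HasDerivAt Ai1 (z * Ai z) z := by
  have h := ((exp_hasDerivAt' z).mul ((airyM_hasDerivAt' 0 z).neg.sub 
    ((airyM_hasDerivAt' 1 z).const_mul Complex.I))).const_mul ((2 * Real.pi : ℝ) : ℂ)⁻¹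
  refine h.congr_deriv ?_
  rw [Ai_eq_airyM]
  have hi := airyM_ibp 1 (Complex.I * (1 - z)) (by simp)
  simp only [zero_add, Pi.sub_apply, Pi.neg_apply, Nat.reduceAdd]
  have := Complex.I_sq
  linear_combination -((2 * Real.pi : ℝ) : ℂ)⁻¹ * Complex.exp (1/3 - z) * (Complex.I * hi 
    - (1-z) * airyM 0 1 (Complex.I * (1 - z)) * this)
/-- upper bound -/
lemma airyM_upper (w : ℂ) (hw : 0 < w.re) : ‖airyM 0 w 0‖ ≤ √(Real.pi / w.re) := by
  have h := airyM_norm_le 0 w 0 hw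
  rw [← integral_gaussian]
  simpa using h

lemma airy_scale (a : ℝ) (ha : 0 < a) :
    ∫ t : ℝ, |t|^3 * Real.exp (-a * t^2) =
      (a^2)⁻¹ * ∫ t : ℝ, |t|^3 * Real.exp (-1 * t^2) := by
  have hs : 0 < √a := Real.sqrt_pos.2 ha
  have h := Measure.integral_comp_mul_left (fun t : ℝ => |t|^3 * Real.exp (-1 * t^2)) (√a)
  rw [abs_of_pos (inv_pos.2 hs), smul_eq_mul] at h
  have e : ∀ t : ℝ, |√a * t|^3 * Real.exp (-1 * (√a * t)^2) =
      (√a)^3 * (|t|^3 * Real.exp (-a * t^2)) := by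
    intro t
    rw [abs_mul, abs_of_pos hs, mul_pow (√a) t 2, Real.sq_sqrt ha.le]
    ring_nf
  simp only [e] at h
  rw [integral_const_mul] at h
  have h4 : a^2 = √a^4 := by
    calc a^2 = (√a^2)^2 := by rw [Real.sq_sqrt ha.le]
      _ = _ := by ring
  rw [h4]
  field_simp
  field_simp at h
  linarith

lemma airyM_approx : ∃ K : ℝ, 0 < K ∧ ∀ w : ℂ, 0 < w.re →
    √(Real.pi / ‖w‖) - K / w.re^2 ≤ ‖airyM 0 w 0‖ := by
  set K0 := ∫ t : ℝ, |t|^3 * Real.exp (-1 * t^2) with hK0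
  have hK0' : 0 ≤ K0 := integral_nonneg fun t => by positivity
  refine ⟨K0 + 1, by positivity, fun w hw => ?_⟩
  have hg : ∫ t : ℝ, Complex.exp (-w * (t:ℂ)^2) = (Real.pi / w) ^ (1/2 : ℂ) :=
    integral_gaussian_complex hw
  have hw0 : w ≠ 0 := by rintro rfl; simp at hw
  have hgn : ‖∫ t : ℝ, Complex.exp (-w * (t:ℂ)^2)‖ = √(Real.pi / ‖w‖) := by
    rw [hg, show (1/2 : ℂ) = ((1/2 : ℝ) : ℂ) by push_cast; rfl, Complex.norm_cpow_real, norm_div,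
      Complex.norm_real, Real.norm_of_nonneg Real.pi_pos.le, Real.sqrt_eq_rpow]
  have ig : Integrable (fun t : ℝ => Complex.exp (-w * (t:ℂ)^2)) := integrable_cexp_neg_mul_sq hw
  have im := airy_integrable 0 w 0 hw
  have hdiff : ‖(∫ t : ℝ, Complex.exp (-w * (t:ℂ)^2)) - airyM 0 w 0‖ ≤ K0 / w.re^2 := by
    rw [airyM, ← integral_sub ig im, div_eq_inv_mul, hK0, ← airy_scale _ hw]
    have hd := airy_dom 3 w.re 0 hw
    simp only [zero_mul, add_zero] at hd
    refine norm_integral_le_of_norm_le hd (Eventually.of_forall fun t => ?_)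
    have e : Complex.exp (-w * (t:ℂ)^2) - (t:ℂ)^0 *
        Complex.exp (-w * (t:ℂ)^2 + 0 * t - Complex.I * (t:ℂ)^3 / 3) =
        - (Complex.exp (-w * (t:ℂ)^2) * (Complex.exp (Complex.I * ((-t^3/3 : ℝ) : ℂ)) - 1)) := by
      rw [mul_sub, ← Complex.exp_add, pow_zero, one_mul, zero_mul, add_zero, mul_one]
      rw [show -w * (t:ℂ)^2 - Complex.I * (t:ℂ)^3 / 3 =
        -w * (t:ℂ)^2 + Complex.I * ((-t^3/3 : ℝ) : ℂ) by push_cast; ring]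
      ring
    rw [e, norm_neg, norm_mul]
    have n1 : ‖Complex.exp (-w * (t:ℂ)^2)‖ = Real.exp (-w.re * t^2) := by
      rw [Complex.norm_exp]
      congr 1
      have h2 : ((t:ℂ)^2) = ((t^2 : ℝ) : ℂ) := by push_cast; ring
      rw [h2, Complex.re_mul_ofReal, Complex.neg_re]
    have n2 : ‖Complex.exp (Complex.I * ((-t^3/3 : ℝ) : ℂ)) - 1‖ ≤ |t|^3 := by
      refine Real.norm_exp_I_mul_ofReal_sub_one_le.trans ?_
      rw [Real.norm_eq_abs, abs_div, abs_neg, abs_pow]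
      have : 0 ≤ |t|^3 := by positivity
      have h3 : |(3:ℝ)| = 3 := by norm_num
      rw [h3]
      linarith
    rw [n1, mul_comm]
    gcongr
  have h1 := norm_sub_norm_le (∫ t : ℝ, Complex.exp (-w * (t:ℂ)^2)) (airyM 0 w 0)
  rw [hgn] at h1
  have h2 : K0 / w.re^2 ≤ (K0 + 1) / w.re^2 := by gcongr; linarith
  linarith

/-- lower bound for large parameter -/
lemma airyM_lower (κ : ℝ) (hκ : 0 < κ) : ∃ R : ℝ, 1 ≤ R ∧ ∀ w : ℂ, κ * ‖w‖ ≤ w.re → R ≤ ‖w‖ →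
    1 / √‖w‖ ≤ 2 * ‖airyM 0 w 0‖ := by
  obtain ⟨K, hK, h⟩ := airyM_approx
  refine ⟨max 1 (2 * K / κ^2), le_max_left _ _, fun w hw hR => ?_⟩
  have h1 : 1 ≤ ‖w‖ := (le_max_left _ _).trans hR
  have h2 : 2 * K / κ^2 ≤ ‖w‖ := (le_max_right _ _).trans hR
  have hre : 0 < w.re := lt_of_lt_of_le (by positivity) hw
  have h3 := h w hre
  have hs : 0 < √‖w‖ := Real.sqrt_pos.2 (by linarith)
  have h4 : 1 / √‖w‖ ≤ √(Real.pi / ‖w‖) := by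
    rw [Real.sqrt_div Real.pi_pos.le]
    gcongr
    rw [Real.one_le_sqrt]
    linarith [Real.pi_gt_three]
  have h5 : K / w.re^2 ≤ (1/2) * (1 / √‖w‖) := by
    have : K / w.re^2 ≤ K / (κ * ‖w‖)^2 := by gcongr
    refine this.trans ?_
    have h6 : √‖w‖ ≤ ‖w‖ := Real.sqrt_le_iff.2 ⟨by linarith, by nlinarith⟩
    have h7 : K / (κ * ‖w‖)^2 ≤ (1/2) * (1/‖w‖) := by
      rw [div_le_iff₀ (by positivity)] at h2 ⊢
      have : (1/2) * (1/‖w‖) * (κ * ‖w‖)^2 = (1/2) * (‖w‖ * κ^2) := by field_simp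
      rw [this]; linarith
    refine h7.trans ?_
    gcongr
  linarith

lemma airy_sector (κ : ℝ) (hκ : 0 < κ) (hκ1 : κ ≤ 1) (v w : ℂ) (x : ℝ) (hx : 0 ≤ x)
    (h : v^2 = w^2 + x) (hv : 0 ≤ v.re) (hw : κ * ‖w‖ ≤ w.re) :
    κ * ‖v‖ ≤ v.re ∧ w.re ≤ v.re ∧ 0 ≤ v.re * w.re + v.im * w.im := by
  have hp : 0 ≤ w.re := le_trans (by positivity) hw
  have e1 := congrArg Complex.re h
  have e2 := congrArg Complex.im h
  simp [pow_two] at e1 e2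
  have hw2 : κ^2 * (w.re^2 + w.im^2) ≤ w.re^2 := by
    have := pow_le_pow_left₀ (by positivity) hw 2
    rw [mul_pow, Complex.sq_norm, Complex.normSq_apply] at this
    nlinarith
  set p := w.re
  set q := w.im
  set r := v.re
  set s := v.im
  have e3 : r * s = p * q := by linarith
  have e4 : r^2 * s^2 = p^2 * q^2 := by rw [← mul_pow, e3, mul_pow]
  have e5 : r^2 - s^2 = p^2 - q^2 + x := by nlinarith
  have hk2 : 0 < κ^2 := by positivity
  have hk3 : κ^2 ≤ 1 := pow_le_one₀ hκ.le hκ1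
  have P0 := sq_nonneg p
  have Q0 := sq_nonneg q
  have R0 := sq_nonneg r
  have S0 := sq_nonneg s
  have hRP : p^2 ≤ r^2 := by
    by_contra hc
    push Not at hc
    have a1 : 0 < q^2 - s^2 := by linarith
    have a2 : r^2 * (s^2 - q^2) = (p^2 - r^2) * q^2 := by linarith
    have a3 : r^2 * (q^2 - s^2) ≥ 0 := by positivity
    have a4 : 0 < q^2 := by linarith
    have a5 : 0 < (p^2 - r^2) * q^2 := mul_pos (by linarith) a4
    linarith
  have hSQ : s^2 ≤ q^2 := by
    by_contra hc
    push Not at hc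
    have a1 : 0 < r^2 - p^2 := by linarith
    have a2 : r^2 * s^2 - p^2 * q^2 = (r^2 - p^2) * s^2 + p^2 * (s^2 - q^2) := by ring
    have a3 : 0 < (r^2 - p^2) * s^2 := mul_pos a1 (by linarith)
    have a4 : 0 ≤ p^2 * (s^2 - q^2) := mul_nonneg P0 (by linarith)
    linarith
  have hrp : p ≤ r := by
    exact le_of_sq_le_sq hRP hv
  refine ⟨?_, hrp, ?_⟩
  · apply le_of_sq_le_sq _ hv
    rw [mul_pow, Complex.sq_norm, Complex.normSq_apply]
    change κ^2 * (r * r + s * s) ≤ r^2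
    have b1 : (1 - κ^2) * p^2 ≤ (1 - κ^2) * r^2 := mul_le_mul_of_nonneg_left hRP (by linarith)
    have b2 : κ^2 * s^2 ≤ κ^2 * q^2 := mul_le_mul_of_nonneg_left hSQ hk2.le
    nlinarith
  · have c1 : 0 ≤ r * p := mul_nonneg hv hp
    have c2 : 0 ≤ s * q := by
      rcases hp.eq_or_lt with hp0 | hp0
      · have : q^2 ≤ 0 := by rw [← hp0] at hw2; nlinarith
        have : q = 0 := by nlinarith
        rw [this]; simp
      · have hr0 : 0 < r := lt_of_lt_of_le hp0 hrp
        have : r * (s * q) = p * q^2 := by rw [← mul_assoc, e3]; ring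
        have h' : 0 ≤ r * (s * q) := by rw [this]; positivity
        exact nonneg_of_mul_nonneg_right h' hr0
    linarith

lemma airy_cubic (κ : ℝ) (hκ : 0 < κ) (v w : ℂ) (x : ℝ) (hx : 0 ≤ x)
    (h : v^2 = w^2 + x) (hv : κ * ‖v‖ ≤ v.re) (hw : κ * ‖w‖ ≤ w.re)
    (hvw : 0 ≤ v.re * w.re + v.im * w.im) :
    x * (κ / 4) * (‖v‖ + ‖w‖) ≤ (v^3 - w^3).re := by
  have hv0 : 0 ≤ v.re := le_trans (by positivity) hv
  have hw0 : 0 ≤ w.re := le_trans (by positivity) hw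
  by_cases hz : v + w = 0
  · have h1 : v.re + w.re = 0 := by simpa using congrArg Complex.re hz
    have h2 : ‖v‖ ≤ 0 := by
      have : κ * ‖v‖ ≤ 0 := by linarith
      by_contra hc
      push Not at hc
      have := mul_pos hκ hc
      linarith
    have h3 : ‖w‖ ≤ 0 := by
      have : κ * ‖w‖ ≤ 0 := by linarith
      by_contra hc
      push Not at hc
      have := mul_pos hκ hc
      linarith
    have h4 : v = 0 := norm_le_zero_iff.1 h2
    have h5 : w = 0 := norm_le_zero_iff.1 h3
    simp [h4, h5]
  · have hN : 0 < ‖v + w‖^2 := by have := norm_pos_iff.2 hz; positivity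
    have V2 : ‖v‖^2 = v.re^2 + v.im^2 := by rw [Complex.sq_norm, Complex.normSq_apply]; ring
    have W2 : ‖w‖^2 = w.re^2 + w.im^2 := by rw [Complex.sq_norm, Complex.normSq_apply]; ring
    have N2 : ‖v + w‖^2 = (v.re + w.re)^2 + (v.im + w.im)^2 := by
      rw [Complex.sq_norm, Complex.normSq_apply]; simp; ring
    have hx' : (x:ℂ) = v^2 - w^2 := by rw [h]; ring
    have key : (v^3 - w^3) * ((‖v + w‖^2 : ℝ) : ℂ) =
        (x:ℂ) * ((v^2 + v * w + w^2) * (starRingEnd ℂ) (v + w)) := by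
      rw [show ((‖v + w‖^2 : ℝ) : ℂ) = (v + w) * (starRingEnd ℂ) (v + w) by
        rw [Complex.mul_conj, Complex.normSq_eq_norm_sq], hx']
      ring
    have key2 := congrArg Complex.re key
    rw [Complex.re_mul_ofReal, Complex.re_ofReal_mul] at key2
    have U : v.re * ‖v‖^2 + w.re * ‖w‖^2 ≤ ((v^2 + v * w + w^2) * (starRingEnd ℂ) (v + w)).re := by
      have : ((v^2 + v * w + w^2) * (starRingEnd ℂ) (v + w)).re =
          v.re * ‖v‖^2 + w.re * ‖w‖^2 + 2 * (v.re + w.re) * (v.re * w.re + v.im * w.im) := by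
        rw [V2, W2]
        simp [pow_two]
        ring
      rw [this]
      have : 0 ≤ 2 * (v.re + w.re) * (v.re * w.re + v.im * w.im) := by positivity
      linarith
    have U2 : κ * (‖v‖^3 + ‖w‖^3) ≤ v.re * ‖v‖^2 + w.re * ‖w‖^2 := by
      have a1 : κ * ‖v‖ * ‖v‖^2 ≤ v.re * ‖v‖^2 := by gcongr
      have a2 : κ * ‖w‖ * ‖w‖^2 ≤ w.re * ‖w‖^2 := by gcongr
      linarith
    have N3 : ‖v + w‖^2 ≤ 2 * (‖v‖^2 + ‖w‖^2) := by
      rw [V2, W2, N2]; nlinarith [sq_nonneg (v.re - w.re), sq_nonneg (v.im - w.im)]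
    have C3 : (‖v‖ + ‖w‖) * (‖v‖^2 + ‖w‖^2) ≤ 2 * (‖v‖^3 + ‖w‖^3) := by
      have : 2 * (‖v‖^3 + ‖w‖^3) - (‖v‖ + ‖w‖) * (‖v‖^2 + ‖w‖^2) =
        (‖v‖ + ‖w‖) * (‖v‖ - ‖w‖)^2 := by ring
      have : 0 ≤ (‖v‖ + ‖w‖) * (‖v‖ - ‖w‖)^2 := by positivity
      linarith
    refine le_of_mul_le_mul_right ?_ hN
    rw [key2]
    calc x * (κ/4) * (‖v‖ + ‖w‖) * ‖v + w‖^2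
        ≤ x * (κ/4) * (‖v‖ + ‖w‖) * (2 * (‖v‖^2 + ‖w‖^2)) := by gcongr
      _ = x * (κ/2) * ((‖v‖ + ‖w‖) * (‖v‖^2 + ‖w‖^2)) := by ring
      _ ≤ x * (κ/2) * (2 * (‖v‖^3 + ‖w‖^3)) := by gcongr
      _ = x * (κ * (‖v‖^3 + ‖w‖^3)) := by ring
      _ ≤ _ := by gcongr; exact U2.trans U
lemma airyM_ray_bound (k : ℕ) (z : ℂ) : ∃ C : ℝ, ∀ x : ℝ,
    ‖airyM k 1 (Complex.I * (1 - (z + x)))‖ ≤ C := by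
  refine ⟨∫ t : ℝ, |t|^k * Real.exp (-(1:ℂ).re * t^2 + |z.im| * |t|), fun x => ?_⟩
  have h := airyM_norm_le k 1 (Complex.I * (1 - (z + x))) (by simp)
  have e : (Complex.I * (1 - (z + x))).re = z.im := by simp
  rw [e] at h
  exact h

lemma airy_exp_ray (z : ℂ) : 
    Tendsto (fun x : ℝ => ‖Complex.exp (1/3 - (z + x))‖) atTop (𝓝 0) := by
  have : (fun x : ℝ => ‖Complex.exp (1/3 - (z + x))‖) = 
      fun x : ℝ => Real.exp (1/3 - z.re) * Real.exp (-x) := by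
    ext x
    rw [Complex.norm_exp, ← Real.exp_add]
    congr 1
    rw [show (1/3 : ℂ) = ((1/3 : ℝ) : ℂ) by push_cast; rfl]
    simp only [Complex.sub_re, Complex.add_re, Complex.ofReal_re]
    ring
  rw [this]
  simpa using (Real.tendsto_exp_neg_atTop_nhds_zero).const_mul (Real.exp (1/3 - z.re))

lemma airy_ray_tendsto (z : ℂ) (g : ℝ → ℂ) (C : ℝ) (hg : ∀ x, ‖g x‖ ≤ C) (d : ℂ) :
    Tendsto (fun x : ℝ => d * (Complex.exp (1/3 - (z + x)) * g x)) atTop (𝓝 0) := by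
  have h0 : Tendsto (fun x : ℝ => Complex.exp (1/3 - (z + x))) atTop (𝓝 0) :=
    tendsto_zero_iff_norm_tendsto_zero.2 (airy_exp_ray z)
  have h1 : Tendsto (fun x : ℝ => Complex.exp (1/3 - (z + x)) * g x) atTop (𝓝 0) := by
    refine h0.zero_mul_isBoundedUnder_le ?_
    exact isBoundedUnder_of ⟨C, hg⟩
  simpa using h1.const_mul d

lemma Ai_ray_tendsto (z : ℂ) : Tendsto (fun x : ℝ => Ai (z + x)) atTop (𝓝 0) := by
  obtain ⟨C, hC⟩ := airyM_ray_bound 0 z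
  simp only [Ai_eq_airyM]
  exact airy_ray_tendsto z _ C hC _

lemma Ai1_ray_tendsto (z : ℂ) : Tendsto (fun x : ℝ => Ai1 (z + x)) atTop (𝓝 0) := by
  obtain ⟨C, hC⟩ := airyM_ray_bound 0 z
  obtain ⟨C', hC'⟩ := airyM_ray_bound 1 z
  simp only [Ai1]
  refine airy_ray_tendsto z _ (C + C') (fun x => ?_) _
  refine (norm_sub_le _ _).trans ?_
  rw [norm_neg, norm_mul, Complex.norm_I, one_mul]
  exact add_le_add (hC x) (hC' x)

/-- if `Ai` vanishes at a point off the negative axis, it vanishes on the whole ray to the right -/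
lemma Ai_zero_ray (z e : ℂ) (he : 0 < e.re) (hez : 0 ≤ (e * z).re) (h0 : Ai z = 0) :
    ∀ x : ℝ, 0 < x → Ai (z + x) = 0 := by
  set F : ℝ → ℂ := fun x => e * (Ai1 (z + x) * (starRingEnd ℂ) (Ai (z + x))) with hF
  set G : ℝ → ℝ := fun x => (F x).re with hG
  set G' : ℝ → ℝ := fun x => ((e * z).re + e.re * x) * ‖Ai (z + x)‖^2 + e.re * ‖Ai1 (z + x)‖^2
    with hG'
  have hd : ∀ x : ℝ, HasDerivAt G (G' x) x := by
    intro x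
    have hl : HasDerivAt (fun x : ℝ => z + (x:ℂ)) 1 x := by
      have h0 : HasDerivAt (fun t : ℝ => (t:ℂ)) 1 x := Complex.ofRealCLM.hasDerivAt
      exact h0.const_add z
    have h1 : HasDerivAt (fun x : ℝ => Ai (z + x)) (Ai1 (z + x)) x := by
      have := (Ai_hasDerivAt (z + x)).comp x hl
      rw [mul_one] at this
      exact this
    have h2 : HasDerivAt (fun x : ℝ => Ai1 (z + x)) ((z + x) * Ai (z + x)) x := by
      have := (Ai1_hasDerivAt (z + x)).comp x hl
      rw [mul_one] at this
      exact this
    have h3 : HasDerivAt (fun x : ℝ => (starRingEnd ℂ) (Ai (z + x)))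
        ((starRingEnd ℂ) (Ai1 (z + x))) x := by
      have := h1.star
      simpa using this
    have h4 := (h2.mul h3).const_mul e
    have h5 := Complex.reCLM.hasFDerivAt.comp_hasDerivAt x h4
    refine h5.congr_deriv ?_
    simp only [hG']
    rw [Complex.sq_norm, Complex.sq_norm]
    have : e * ((z + x) * Ai (z + x) * (starRingEnd ℂ) (Ai (z + x)) +
        Ai1 (z + x) * (starRingEnd ℂ) (Ai1 (z + x))) =
        (e * z + e * x) * (Complex.normSq (Ai (z + x)) : ℝ)
          + e * (Complex.normSq (Ai1 (z + x)) : ℝ) := by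
      rw [← Complex.mul_conj, ← Complex.mul_conj]; ring
    simp only [Complex.reCLM_apply]
    rw [this, Complex.add_re, Complex.re_mul_ofReal, Complex.re_mul_ofReal, Complex.add_re,
      Complex.re_mul_ofReal]
  have hmono : MonotoneOn G (Set.Ici 0) := by
    refine monotoneOn_of_deriv_nonneg (convex_Ici 0)
      (fun x _ => (hd x).continuousAt.continuousWithinAt)
      (fun x _ => (hd x).differentiableAt.differentiableWithinAt) (fun x hx => ?_)
    rw [interior_Ici] at hx
    have hx' : 0 < x := hx
    rw [(hd x).deriv]
    positivity
  have hG0 : G 0 = 0 := by simp [hG, hF, h0]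
  have hlim : Tendsto G atTop (𝓝 0) := by
    have h1 : Tendsto F atTop (𝓝 0) := by
      have := ((Ai1_ray_tendsto z).mul (Ai_ray_tendsto z).star).const_mul e
      simpa using this
    have := (Complex.continuous_re.tendsto 0).comp h1
    rw [Complex.zero_re] at this
    exact this
  have hGz : ∀ x : ℝ, 0 ≤ x → G x = 0 := by
    intro x hx
    apply le_antisymm
    · refine ge_of_tendsto hlim ?_
      filter_upwards [eventually_ge_atTop x] with y hy
      exact hmono hx (hx.trans hy) hy
    · rw [← hG0]; exact hmono (Set.self_mem_Ici) hx hx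
  intro x hx
  have hev : G =ᶠ[𝓝 x] fun _ => 0 := by
    filter_upwards [lt_mem_nhds hx] with y hy
    exact hGz y hy.le
  have hz : G' x = 0 := by
    rw [← (hd x).deriv, hev.deriv_eq]; simp
  simp only [hG'] at hz
  have t2 : 0 ≤ e.re * ‖Ai1 (z + x)‖^2 := by positivity
  have t1 : 0 < (e * z).re + e.re * x := by positivity
  have t3 : ((e * z).re + e.re * x) * ‖Ai (z + x)‖^2 ≤ 0 := by linarith
  have t4 : ‖Ai (z + x)‖^2 ≤ 0 := by
    by_contra hc
    push Not at hc
    have := mul_pos t1 hc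
    linarith
  have t5 : ‖Ai (z + x)‖ = 0 := by
    have := sq_nonneg ‖Ai (z + x)‖
    exact pow_eq_zero_iff (two_ne_zero) |>.1 (le_antisymm t4 this)
  exact norm_eq_zero.1 t5

lemma airy_exists_sqrt (z : ℂ) : ∃ v : ℂ, v^2 = z ∧ 0 ≤ v.re := by
  obtain ⟨v, hv⟩ := IsAlgClosed.exists_pow_nat_eq z (n := 2) two_pos
  rcases le_total 0 v.re with h | h
  · exact ⟨v, hv, h⟩
  · exact ⟨-v, by rw [neg_sq, hv], by simpa using h⟩

lemma Ai_ne_zero (κ : ℝ) (hκ : 0 < κ) (hκ1 : κ ≤ 1) (w : ℂ) (hw : κ * ‖w‖ ≤ w.re) :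
    Ai (w^2) ≠ 0 := by
  intro h0
  obtain ⟨R, hR1, hR⟩ := airyM_lower κ hκ
  have hray : ∀ x : ℝ, 0 < x → Ai (w^2 + x) = 0 := by
    by_cases hw0 : w = 0
    · exact Ai_zero_ray _ 1 (by simp) (by simp [hw0]) h0
    · have hn : 0 < ‖w‖ := norm_pos_iff.2 hw0
      have hre : 0 < w.re := lt_of_lt_of_le (by positivity) hw
      refine Ai_zero_ray _ ((starRingEnd ℂ) w) (by simpa using hre) ?_ h0
      have : (starRingEnd ℂ) w * w^2 = (Complex.normSq w : ℝ) * w := by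
        rw [← Complex.mul_conj]; ring
      rw [this, Complex.re_ofReal_mul]
      exact mul_nonneg (Complex.normSq_nonneg _) hre.le
  set x : ℝ := R^2 + ‖w‖^2 with hx
  have hx0 : 0 < x := by positivity
  obtain ⟨v, hv, hv0⟩ := airy_exists_sqrt (w^2 + x)
  obtain ⟨s1, s2, s3⟩ := airy_sector κ hκ hκ1 v w x hx0.le hv hv0 hw
  have hvR : R ≤ ‖v‖ := by
    apply le_of_sq_le_sq _ (norm_nonneg _)
    rw [← norm_pow, hv]
    have := norm_sub_le (w^2 + (x:ℂ)) (w^2)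
    rw [add_sub_cancel_left, Complex.norm_real, Real.norm_of_nonneg hx0.le, norm_pow] at this
    linarith
  have hv1 : 0 < ‖v‖ := by linarith
  have hvre : 0 < v.re := lt_of_lt_of_le (by positivity) s1
  have h1 := hR v s1 hvR
  have h2 := hray x hx0
  rw [← hv, Ai_sq v hvre] at h2
  have h3 : airyM 0 v 0 = 0 := by
    rcases mul_eq_zero.1 h2 with h | h
    · exfalso
      have := Real.pi_pos.ne'
      simp at h
    · rcases mul_eq_zero.1 h with h | h
      · exact absurd h (Complex.exp_ne_zero _)
      · exact h
  rw [h3, norm_zero, mul_zero] at h1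
  have : 0 < 1 / √‖v‖ := by have := Real.sqrt_pos.2 hv1; positivity
  linarith

/-- normalised Airy function -/
def airyG (w : ℂ) : ℂ := Complex.exp ((2/3) * w^3) * Ai (w^2)

lemma airyG_continuous : Continuous airyG := by
  have : Continuous Ai := continuous_iff_continuousAt.2 fun z => (Ai_hasDerivAt z).continuousAt
  unfold airyG
  fun_prop

lemma airyG_eq (w : ℂ) (hw : 0 < w.re) :
    airyG w = ((2 * Real.pi : ℝ) : ℂ)⁻¹ * airyM 0 w 0 := by
  rw [airyG, Ai_sq w hw, ← mul_assoc, mul_comm _ (((2 * Real.pi : ℝ) : ℂ)⁻¹), mul_assoc, ← mul_assoc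
    (Complex.exp _), ← Complex.exp_add]
  rw [show (2/3) * w^3 + -(2/3) * w^3 = 0 by ring, Complex.exp_zero, one_mul]

lemma airyG_norm (w : ℂ) (hw : 0 < w.re) :
    ‖airyG w‖ = (2 * Real.pi)⁻¹ * ‖airyM 0 w 0‖ := by
  rw [airyG_eq w hw, norm_mul, norm_inv, Complex.norm_real, Real.norm_of_nonneg (by positivity)]

lemma airyG_bounds (κ : ℝ) (hκ : 0 < κ) (hκ1 : κ ≤ 1) : ∃ m M : ℝ, 0 < m ∧ 0 < M ∧
    ∀ w : ℂ, κ * ‖w‖ ≤ w.re → m ≤ ‖airyG w‖ * √(1 + ‖w‖) ∧ ‖airyG w‖ * √(1 + ‖w‖) ≤ M := by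
  obtain ⟨R, hR1, hR⟩ := airyM_lower κ hκ
  set S : Set ℂ := {w | κ * ‖w‖ ≤ w.re} ∩ Metric.closedBall 0 R with hS
  have hcl : IsClosed {w : ℂ | κ * ‖w‖ ≤ w.re} :=
    isClosed_le (by fun_prop) Complex.continuous_re
  have hSc : IsCompact S := (isCompact_closedBall 0 R).inter_left hcl
  have hSn : S.Nonempty := ⟨0, by simp [hS]; linarith⟩
  have hc : ContinuousOn (fun w => ‖airyG w‖ * √(1 + ‖w‖)) S := by
    have := airyG_continuous
    fun_prop
  obtain ⟨w1, hw1, hmin⟩ := hSc.exists_isMinOn hSn hc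
  obtain ⟨w2, hw2, hmax⟩ := hSc.exists_isMaxOn hSn hc
  have hm1 : 0 < ‖airyG w1‖ * √(1 + ‖w1‖) := by
    have : airyG w1 ≠ 0 := mul_ne_zero (Complex.exp_ne_zero _) (Ai_ne_zero κ hκ hκ1 w1 hw1.1)
    have := norm_pos_iff.2 this
    positivity
  refine ⟨min (‖airyG w1‖ * √(1 + ‖w1‖)) ((2 * Real.pi)⁻¹ * (1/2)),
    max (‖airyG w2‖ * √(1 + ‖w2‖)) ((2 * Real.pi)⁻¹ * √(2 * Real.pi / κ)),
    lt_min hm1 (by positivity), lt_max_of_lt_right (by positivity), fun w hw => ?_⟩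
  rcases le_total ‖w‖ R with h | h
  · have hwS : w ∈ S := ⟨hw, by simpa using h⟩
    exact ⟨(min_le_left _ _).trans (hmin hwS), le_trans (hmax hwS) (le_max_left _ _)⟩
  · have hn : 1 ≤ ‖w‖ := hR1.trans h
    have hre : 0 < w.re := lt_of_lt_of_le (by positivity) hw
    rw [airyG_norm w hre]
    constructor
    · refine (min_le_right _ _).trans ?_
      rw [mul_assoc]
      gcongr
      have h1 := hR w hw h
      have hs : 0 < √‖w‖ := Real.sqrt_pos.2 (by linarith)
      have h2 : √‖w‖ ≤ √(1 + ‖w‖) := Real.sqrt_le_sqrt (by linarith)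
      rw [div_le_iff₀ hs] at h1
      have : ‖airyM 0 w 0‖ * √‖w‖ ≤ ‖airyM 0 w 0‖ * √(1 + ‖w‖) := by gcongr
      linarith
    · refine le_trans ?_ (le_max_right _ _)
      rw [mul_assoc]
      gcongr
      calc ‖airyM 0 w 0‖ * √(1 + ‖w‖) ≤ √(Real.pi / w.re) * √(1 + ‖w‖) := by
            gcongr; exact airyM_upper w hre
        _ = √(Real.pi / w.re * (1 + ‖w‖)) := by rw [Real.sqrt_mul (by positivity)]
        _ ≤ √(2 * Real.pi / κ) := by
            apply Real.sqrt_le_sqrt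
            rw [div_mul_eq_mul_div, div_le_div_iff₀ hre hκ]
            have : (1 + ‖w‖) * κ ≤ 2 * w.re := by nlinarith
            nlinarith [Real.pi_pos]

/-- Main estimate in the variable `w = √z`. -/
lemma Ai_ratio_sq (κ : ℝ) (hκ : 0 < κ) (hκ1 : κ ≤ 1) : ∃ C : ℝ, 0 < C ∧
    ∀ w : ℂ, κ * ‖w‖ ≤ w.re → ∀ x : ℝ, 0 ≤ x →
      ‖Ai (w^2 + x) / Ai (w^2)‖ ≤ C * Real.exp (-(κ/12) * x * ‖w‖ - (κ/12) * (x * √x)) := by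
  obtain ⟨m, M, hm, hM, hb⟩ := airyG_bounds κ hκ hκ1
  refine ⟨M / m * √(1/κ), by positivity, fun w hw x hx => ?_⟩
  obtain ⟨v, hv, hv0⟩ := airy_exists_sqrt (w^2 + x)
  obtain ⟨s1, s2, s3⟩ := airy_sector κ hκ hκ1 v w x hx hv hv0 hw
  have hcub := airy_cubic κ hκ v w x hx hv s1 hw s3
  rw [← hv]
  have hA : ∀ u : ℂ, Ai (u^2) = Complex.exp (-((2/3) * u^3)) * airyG u := by
    intro u
    rw [airyG, ← mul_assoc, ← Complex.exp_add, neg_add_cancel, Complex.exp_zero, one_mul]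
  have e1 : Ai (v^2) / Ai (w^2) = Complex.exp (((-(2/3) : ℝ) : ℂ) * (v^3 - w^3)) * 
      (airyG v / airyG w) := by
    rw [hA v, hA w, mul_div_mul_comm, ← Complex.exp_sub]
    congr 2
    push_cast
    ring
  rw [e1, norm_mul, norm_div, Complex.norm_exp, Complex.re_ofReal_mul, mul_comm]
  obtain ⟨l1, -⟩ := hb w hw
  obtain ⟨-, l2⟩ := hb v s1
  have hsw : 0 < √(1 + ‖w‖) := Real.sqrt_pos.2 (by positivity)
  have hsv : 0 < √(1 + ‖v‖) := Real.sqrt_pos.2 (by positivity)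
  have hgw : 0 < ‖airyG w‖ := by
    by_contra hc
    push Not at hc
    have : ‖airyG w‖ * √(1 + ‖w‖) ≤ 0 := mul_nonpos_of_nonpos_of_nonneg hc hsw.le
    linarith
  have hvw : κ * ‖w‖ ≤ ‖v‖ := hw.trans (s2.trans (Complex.re_le_norm v))
  have hsq : √(1 + ‖w‖) ≤ √(1/κ) * √(1 + ‖v‖) := by
    rw [← Real.sqrt_mul (by positivity)]
    apply Real.sqrt_le_sqrt
    rw [div_mul_eq_mul_div, le_div_iff₀ hκ]
    nlinarith
  gcongr
  · rw [div_le_iff₀ hgw]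
    have a1 : ‖airyG v‖ ≤ M / √(1 + ‖v‖) := by rwa [le_div_iff₀ hsv]
    refine a1.trans ?_
    rw [div_le_iff₀ hsv]
    calc M = M / m * m := by field_simp
      _ ≤ M / m * (‖airyG w‖ * √(1 + ‖w‖)) := by gcongr
      _ ≤ M / m * (‖airyG w‖ * (√(1/κ) * √(1 + ‖v‖))) := by gcongr
      _ = _ := by ring
  · have hxs : √x ≤ ‖v‖ + ‖w‖ := by
      rw [Real.sqrt_le_iff]
      refine ⟨by positivity, ?_⟩
      have : (x:ℂ) = v^2 - w^2 := by rw [hv]; ring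
      have h1 : x = ‖v^2 - w^2‖ := by rw [← this, Complex.norm_real, Real.norm_of_nonneg hx]
      have h2 := norm_sub_le (v^2) (w^2)
      rw [← h1, norm_pow, norm_pow] at h2
      nlinarith [norm_nonneg v, norm_nonneg w, mul_nonneg (norm_nonneg v) (norm_nonneg w)]
    have h3 : ‖w‖ + √x ≤ 2 * (‖v‖ + ‖w‖) := by linarith [norm_nonneg v]
    have h4 : x * (κ/4) * (‖w‖ + √x) ≤ x * (κ/4) * (2 * (‖v‖ + ‖w‖)) := by gcongr
    linarith

theorem Ai_ratio_bound :
    ∀ δ : ℝ, 0 < δ → ∃ c : ℝ, 0 < c ∧ ∃ C : ℝ, 0 < C ∧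
      ∀ z : ℂ, z ≠ 0 → |z.arg| ≤ Real.pi - δ → ∀ x : ℝ, 0 ≤ x →
        Ai z ≠ 0 ∧
        ‖Ai (z + (x : ℂ)) / Ai z‖ ≤
          C * Real.exp (-c * x * ‖z‖ ^ ((1 : ℝ) / 2) - c * x ^ ((3 : ℝ) / 2)) := by
  intro δ hδ
  rcases lt_or_ge Real.pi δ with hπ | hπ
  · refine ⟨1, one_pos, 1, one_pos, fun z _ hz => ?_⟩
    have := abs_nonneg z.arg
    linarith
  set κ := Real.cos ((Real.pi - δ)/2) with hκd
  have hκ : 0 < κ := Real.cos_pos_of_mem_Ioo ⟨by linarith, by linarith⟩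
  have hκ1 : κ ≤ 1 := Real.cos_le_one _
  obtain ⟨C, hC, h⟩ := Ai_ratio_sq κ hκ hκ1
  refine ⟨κ/12, by positivity, C, hC, fun z hz hzarg x hx => ?_⟩
  have hzn : 0 < ‖z‖ := norm_pos_iff.2 hz
  set w : ℂ := (√‖z‖ : ℂ) * Complex.exp (((z.arg/2 : ℝ) : ℂ) * Complex.I) with hw
  have hwn : ‖w‖ = √‖z‖ := by
    rw [hw, norm_mul, Complex.norm_exp_ofReal_mul_I, mul_one, Complex.norm_real,
      Real.norm_of_nonneg (Real.sqrt_nonneg _)]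
  have hw2 : w^2 = z := by
    rw [hw, mul_pow, ← Complex.exp_nat_mul, ← Complex.ofReal_pow, Real.sq_sqrt hzn.le]
    conv_rhs => rw [← Complex.norm_mul_exp_arg_mul_I z]
    congr 2
    push_cast
    ring
  have hwre : κ * ‖w‖ ≤ w.re := by
    have : w.re = √‖z‖ * Real.cos (z.arg/2) := by
      rw [hw, Complex.re_ofReal_mul, Complex.exp_ofReal_mul_I_re]
    rw [this, hwn, mul_comm]
    gcongr
    rw [hκd, ← Real.cos_abs (z.arg/2)]
    apply Real.cos_le_cos_of_nonneg_of_le_pi (abs_nonneg _) (by linarith)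
    rw [abs_div, abs_two]
    linarith
  have h1 := h w hwre x hx
  have h2 := Ai_ne_zero κ hκ hκ1 w hwre
  rw [hw2] at h1 h2
  refine ⟨h2, ?_⟩
  rw [hwn, Real.sqrt_eq_rpow] at h1
  have hx32 : x ^ ((3:ℝ)/2) = x * √x := by
    rw [Real.sqrt_eq_rpow, show (3:ℝ)/2 = 1 + 1/2 by norm_num,
      Real.rpow_add' hx (by norm_num), Real.rpow_one]
  rw [hx32]
  exact h1
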